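/- Let 𝓛 : ℝ^{m×n} → ℝ be differentiable with Frobenius gradient map G : ℝ^{m×n} → ℝ^{m×n} satisfying ‖G(W) − G(W′)‖_F ≤ L₀ ‖W − W′‖_F for all W, W′ (L₀-smoothness). Let B ∈ ℝ^{m×r} have full column rank r and A ∈ ℝ^{r×n} have full row rank r, and set Q := Proj_{c(B)} and P := Proj_{r(A)}. Given W_k ∈ ℝ^{m×n} and η ≥ 0, define the intermediate iterate W_h := W_k − η Q G(W_k), the two-half-step iterate W_{k+2} := W_h − η G(W_h) P, and the stale-block remainder E_k := −η ( Q (G(W_k) − G(W_h)) + (G(W_h) − G(W_k)) P ). Then W_{k+2} = W_k − η G(W_k) P − η Q G(W_h) + E_k, and ‖E_k‖_F ≤ 2 η² L₀ ‖G(W_k)‖_F. -/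

import Mathlib

open Matrix

/-- Frobenius inner product `⟨M, N⟩_F = trace (Mᵀ * N)`. -/
noncomputable def frobInner {m n : Type*} [Fintype m] [Fintype n]
    (M N : Matrix m n ℝ) : ℝ :=
  Matrix.trace (Mᵀ * N)

/-- Frobenius norm `‖M‖_F = √⟨M, M⟩_F`. -/
noncomputable def frobNorm {m n : Type*} [Fintype m] [Fintype n]
    (M : Matrix m n ℝ) : ℝ :=
  Real.sqrt (frobInner M M)

section FrobeniusNorm

variable {m n r : Type*} [Fintype m] [Fintype n] [Fintype r]

lemma frobInner_self_eq_sum (M : Matrix m n ℝ) :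
    frobInner M M = ∑ i, ∑ j, M i j ^ 2 := by
  rw [Finset.sum_comm]
  simp [frobInner, Matrix.trace, Matrix.mul_apply, sq]

lemma frobInner_self_nonneg (M : Matrix m n ℝ) : 0 ≤ frobInner M M := by
  rw [frobInner_self_eq_sum]
  positivity

lemma frobNorm_nonneg (M : Matrix m n ℝ) : 0 ≤ frobNorm M :=
  Real.sqrt_nonneg _

attribute [local instance] Matrix.frobeniusNormedAddCommGroup Matrix.frobeniusNormedSpace

lemma frobNorm_eq_norm (M : Matrix m n ℝ) : frobNorm M = ‖M‖ := by
  rw [frobNorm, frobInner_self_eq_sum, Matrix.frobenius_norm_def, Real.sqrt_eq_rpow]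
  simp

lemma frobNorm_add_le (M N : Matrix m n ℝ) : frobNorm (M + N) ≤ frobNorm M + frobNorm N := by
  simpa only [frobNorm_eq_norm] using norm_add_le M N

lemma frobNorm_neg (M : Matrix m n ℝ) : frobNorm (-M) = frobNorm M := by
  simp only [frobNorm_eq_norm, norm_neg]

lemma frobNorm_sub_comm (M N : Matrix m n ℝ) : frobNorm (M - N) = frobNorm (N - M) := by
  simp only [frobNorm_eq_norm, norm_sub_rev]

lemma frobNorm_smul (c : ℝ) (M : Matrix m n ℝ) : frobNorm (c • M) = |c| * frobNorm M := by
  simp only [frobNorm_eq_norm, norm_smul, Real.norm_eq_abs]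

lemma frobNorm_transpose (M : Matrix m n ℝ) : frobNorm Mᵀ = frobNorm M := by
  simp only [frobNorm_eq_norm, Matrix.frobenius_norm_transpose]

/-- Left multiplication by an orthogonal projection does not increase the Frobenius norm. -/
lemma frobNorm_mul_le_of_isSymm_of_isIdempotentElem {Q : Matrix m m ℝ} (hs : Q.IsSymm)
    (hi : IsIdempotentElem Q) (M : Matrix m n ℝ) : frobNorm (Q * M) ≤ frobNorm M := by
  have hQ : (Q * M)ᵀ * (Q * M) = Mᵀ * (Q * M) := by
    rw [transpose_mul, hs.eq, Matrix.mul_assoc, ← Matrix.mul_assoc Q Q M, hi.eq]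
  have hQ' : (Q * M)ᵀ * M = Mᵀ * (Q * M) := by
    rw [transpose_mul, hs.eq, Matrix.mul_assoc]
  have key : frobInner (M - Q * M) (M - Q * M) =
      frobInner M M - frobInner (Q * M) (Q * M) := by
    simp only [frobInner, transpose_sub, Matrix.sub_mul, Matrix.mul_sub, hQ, hQ', trace_sub]
    ring
  refine Real.sqrt_le_sqrt ?_
  linarith [frobInner_self_nonneg (M - Q * M)]

/-- Right multiplication by an orthogonal projection does not increase the Frobenius norm. -/
lemma frobNorm_mul_le_of_isSymm_of_isIdempotentElem_right {P : Matrix n n ℝ} (hs : P.IsSymm)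
    (hi : IsIdempotentElem P) (M : Matrix m n ℝ) : frobNorm (M * P) ≤ frobNorm M := by
  rw [← frobNorm_transpose, ← frobNorm_transpose M, transpose_mul, hs.eq]
  exact frobNorm_mul_le_of_isSymm_of_isIdempotentElem hs hi _

variable [DecidableEq r]

lemma isSymm_mul_inv_mul_transpose (B : Matrix m r ℝ) : (B * (Bᵀ * B)⁻¹ * Bᵀ).IsSymm := by
  simp [IsSymm, transpose_nonsing_inv, Matrix.mul_assoc]

/-- No rank assumption is needed, since the inverse of a singular matrix is `0`. -/
lemma isIdempotentElem_mul_inv_mul_transpose (B : Matrix m r ℝ) :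
    IsIdempotentElem (B * (Bᵀ * B)⁻¹ * Bᵀ) := by
  have h : (Bᵀ * B)⁻¹ * (Bᵀ * B) * (Bᵀ * B)⁻¹ = (Bᵀ * B)⁻¹ := by
    by_cases hu : IsUnit (Bᵀ * B).det
    · rw [nonsing_inv_mul _ hu, Matrix.one_mul]
    · simp [nonsing_inv_apply_not_isUnit _ hu]
  calc B * (Bᵀ * B)⁻¹ * Bᵀ * (B * (Bᵀ * B)⁻¹ * Bᵀ)
      = B * ((Bᵀ * B)⁻¹ * (Bᵀ * B) * (Bᵀ * B)⁻¹) * Bᵀ := by simp only [Matrix.mul_assoc]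
    _ = B * (Bᵀ * B)⁻¹ * Bᵀ := by rw [h]

end FrobeniusNorm

/-- A Frobenius-Lipschitz bound transfers along `‖M‖_F ≤ ‖N‖_F` whatever the sign of the
constant: a negative constant forces the norm to vanish. -/
lemma mul_frobNorm_le_mul_frobNorm {m n : Type*} [Fintype m] [Fintype n] {L : ℝ}
    {G : Matrix m n ℝ → Matrix m n ℝ}
    (hLip : ∀ W W', frobNorm (G W - G W') ≤ L * frobNorm (W - W'))
    {M N : Matrix m n ℝ} (h : frobNorm M ≤ frobNorm N) :
    L * frobNorm M ≤ L * frobNorm N := by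
  rcases le_or_gt 0 L with hL | hL
  · exact mul_le_mul_of_nonneg_left h hL
  · have hN := (frobNorm_nonneg _).trans (hLip N 0)
    rw [sub_zero] at hN
    exact (mul_nonpos_of_nonpos_of_nonneg hL.le (frobNorm_nonneg M)).trans hN

/-- RoLoRA stale-block remainder. Let `𝓛` be differentiable with Frobenius
gradient map `G` (in the sense that every directional derivative of `𝓛` is given by the
Frobenius inner product against `G`), and let `G` be `L₀`-Lipschitz in Frobenius norm. With
`Q = Proj_{c(B)}`, `P = Proj_{r(A)}`, intermediate iterate `W_h = W_k − η Q G(W_k)`,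
`W_{k+2} = W_h − η G(W_h) P`, and
`E_k = −η (Q (G(W_k) − G(W_h)) + (G(W_h) − G(W_k)) P)`, one has
`W_{k+2} = W_k − η G(W_k) P − η Q G(W_h) + E_k` and `‖E_k‖_F ≤ 2 η² L₀ ‖G(W_k)‖_F`. -/
theorem stmt18 (r m n : ℕ) (L₀ : ℝ)
    (𝓛 : Matrix (Fin m) (Fin n) ℝ → ℝ)
    (G : Matrix (Fin m) (Fin n) ℝ → Matrix (Fin m) (Fin n) ℝ)
    (hgrad : ∀ W H : Matrix (Fin m) (Fin n) ℝ,
      HasDerivAt (fun t : ℝ => 𝓛 (W + t • H)) (frobInner (G W) H) 0)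
    (hLip : ∀ W W' : Matrix (Fin m) (Fin n) ℝ,
      frobNorm (G W - G W') ≤ L₀ * frobNorm (W - W'))
    (B : Matrix (Fin m) (Fin r) ℝ) (hB : B.rank = r)
    (A : Matrix (Fin r) (Fin n) ℝ) (hA : A.rank = r)
    (Wk : Matrix (Fin m) (Fin n) ℝ) (η : ℝ) (hη : 0 ≤ η) :
    let Q : Matrix (Fin m) (Fin m) ℝ := B * (Bᵀ * B)⁻¹ * Bᵀ
    let P : Matrix (Fin n) (Fin n) ℝ := Aᵀ * (A * Aᵀ)⁻¹ * A
    let Wh : Matrix (Fin m) (Fin n) ℝ := Wk - η • (Q * G Wk)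
    let Wk2 : Matrix (Fin m) (Fin n) ℝ := Wh - η • (G Wh * P)
    let Ek : Matrix (Fin m) (Fin n) ℝ :=
      -(η • (Q * (G Wk - G Wh) + (G Wh - G Wk) * P))
    Wk2 = Wk - η • (G Wk * P) - η • (Q * G Wh) + Ek ∧
      frobNorm Ek ≤ 2 * η ^ 2 * L₀ * frobNorm (G Wk) := by
  intro Q P Wh Wk2 Ek
  have hQs : Q.IsSymm := isSymm_mul_inv_mul_transpose B
  have hQi : IsIdempotentElem Q := isIdempotentElem_mul_inv_mul_transpose B
  have hPs : P.IsSymm := by simpa using isSymm_mul_inv_mul_transpose Aᵀ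
  have hPi : IsIdempotentElem P := by simpa using isIdempotentElem_mul_inv_mul_transpose Aᵀ
  constructor
  · simp only [Wk2, Ek, Matrix.mul_sub, Matrix.sub_mul, smul_add, smul_sub]
    simp only [Wh]
    abel
  · have hstep : frobNorm (G Wk - G Wh) ≤ η * (L₀ * frobNorm (G Wk)) := by
      have hW : Wk - Wh = η • (Q * G Wk) := sub_sub_cancel _ _
      calc frobNorm (G Wk - G Wh) ≤ L₀ * frobNorm (Wk - Wh) := hLip _ _
        _ = η * (L₀ * frobNorm (Q * G Wk)) := by
            rw [hW, frobNorm_smul, abs_of_nonneg hη]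
            ring
        _ ≤ η * (L₀ * frobNorm (G Wk)) :=
            mul_le_mul_of_nonneg_left (mul_frobNorm_le_mul_frobNorm hLip
              (frobNorm_mul_le_of_isSymm_of_isIdempotentElem hQs hQi _)) hη
    have hsum : frobNorm (Q * (G Wk - G Wh) + (G Wh - G Wk) * P) ≤
        2 * (η * (L₀ * frobNorm (G Wk))) := by
      have hQ := frobNorm_mul_le_of_isSymm_of_isIdempotentElem hQs hQi (G Wk - G Wh)
      have hP := frobNorm_mul_le_of_isSymm_of_isIdempotentElem_right hPs hPi (G Wh - G Wk)
      rw [frobNorm_sub_comm (G Wh)] at hP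
      linarith [frobNorm_add_le (Q * (G Wk - G Wh)) ((G Wh - G Wk) * P)]
    calc frobNorm Ek = η * frobNorm (Q * (G Wk - G Wh) + (G Wh - G Wk) * P) := by
          rw [frobNorm_neg, frobNorm_smul, abs_of_nonneg hη]
      _ ≤ η * (2 * (η * (L₀ * frobNorm (G Wk)))) := mul_le_mul_of_nonneg_left hsum hη
      _ = 2 * η ^ 2 * L₀ * frobNorm (G Wk) := by ring
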